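/- Let T be a caterpillar. Then γ'_SMB(T) = ∞ if P_co(T) = ∅, and otherwise γ'_SMB(T) = ⌈log_2 p(T)⌉, where p(T) is the minimum order of an odd maximal clean path of T. -/

import Mathlib

open scoped Classical

open scoped Classical

noncomputable section

/-- Minimax value of the Maker–Breaker game on hypergraph with edge set `E`:
`mbVal E t M B` is the minimum number of further moves Maker needs to claim all
vertices of some hyperedge (Maker has claimed `M`, Breaker has claimed `B`,
`t = true` iff Maker moves next), under optimal play; `⊤` if Maker cannot win. -/
def mbVal {V : Type} [Fintype V] (E : Set (Finset V)) :
    Bool → Finset V → Finset V → ℕ∞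
  | true, M, B =>
      if ∃ e ∈ E, e ⊆ M then 0
      else ⨅ v ∈ Finset.univ \ (M ∪ B), (1 + mbVal E false (insert v M) B)
  | false, M, B =>
      if ∃ e ∈ E, e ⊆ M then 0
      else if Finset.univ \ (M ∪ B) = ∅ then ⊤
      else ⨆ v ∈ Finset.univ \ (M ∪ B), mbVal E true M (insert v B)
termination_by _t M B => (Finset.univ \ (M ∪ B)).card
decreasing_by
  all_goals
    apply Finset.card_lt_card
    rw [Finset.ssubset_iff_of_subset]
    · refine ⟨v, ‹_›, by simp⟩
    · intro x hx
      simp only [Finset.mem_sdiff, Finset.mem_univ, true_and, Finset.mem_union,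
        Finset.mem_insert] at hx ⊢
      tauto

/-- The closed neighborhood of `v` as a finset. -/
def closedNbhdFinset {V : Type} [Fintype V] (G : SimpleGraph V) (v : V) : Finset V :=
  Finset.univ.filter (fun w => w = v ∨ G.Adj v w)

/-- The closed neighborhood hypergraph of a graph. -/
def nbhdHyp {V : Type} [Fintype V] (G : SimpleGraph V) : Set (Finset V) :=
  Set.range (closedNbhdFinset G)

/-- `γ'_SMB(G)`: the number of moves Staller (= Maker on the closed neighborhood
hypergraph, moving first) needs to win the Maker–Breaker domination game on `G`. -/
def gammaSMB' {V : Type} [Fintype V] (G : SimpleGraph V) : ℕ∞ :=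
  mbVal (nbhdHyp G) true ∅ ∅

end


/-- A path `P = u₁u₂…u_k` in `T` is clean if `deg_T(u_i) = 2` for `3 ≤ i ≤ k-2`. -/
def IsCleanPath {V : Type} [Fintype V] (T : SimpleGraph V) {u v : V}
    (P : T.Walk u v) : Prop :=
  P.IsPath ∧ ∀ i : ℕ, 2 ≤ i → i + 3 ≤ P.support.length →
    T.degree (P.support.getD i u) = 2

/-- `P` is an inclusion-maximal path in `T`. -/
def IsMaximalPath {V : Type} (T : SimpleGraph V) {u v : V}
    (P : T.Walk u v) : Prop :=
  P.IsPath ∧ ∀ (a b : V) (Q : T.Walk a b), Q.IsPath →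
    P.support.toFinset ⊆ Q.support.toFinset →
    Q.support.toFinset = P.support.toFinset

/-- A caterpillar: a tree on at least three vertices in which a single path is
incident to (or contains) every edge. -/
def IsCaterpillar {V : Type} [Fintype V] (T : SimpleGraph V) : Prop :=
  T.IsTree ∧ 3 ≤ Fintype.card V ∧ ∃ (u v : V) (P : T.Walk u v), P.IsPath ∧
    ∀ e ∈ T.edgeSet, ∃ x, x ∈ e ∧ x ∈ P.support

/-- `𝒫_co(T)` is nonempty: `T` has an inclusion-maximal clean path of odd order. -/
def HasOddMaximalCleanPath {V : Type} [Fintype V] (T : SimpleGraph V) : Prop :=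
  ∃ (u v : V) (P : T.Walk u v), IsCleanPath T P ∧ IsMaximalPath T P ∧
    Odd P.support.length

section Traps

variable {V : Type} {G : SimpleGraph V} {M B : Finset V} {n : ℕ} {u : ℕ → V}

/-- A trap of order `2 * n + 1` in the position `(M, B)`: a path `u 0, …, u (2 * n)` of unclaimed
vertices such that every vertex of even index has all its neighbours in `M` or next to it on
the path. -/
structure IsTrap (G : SimpleGraph V) (M B : Finset V) (n : ℕ) (u : ℕ → V) : Prop where
  adj : ∀ i < 2 * n, G.Adj (u i) (u (i + 1))
  inj : ∀ i j, i ≤ 2 * n → j ≤ 2 * n → u i = u j → i = j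
  free : ∀ i ≤ 2 * n, u i ∉ M ∧ u i ∉ B
  nbr : ∀ i ≤ n, ∀ w, G.Adj (u (2 * i)) w →
    w ∈ M ∨ ∃ j ≤ 2 * n, (j + 1 = 2 * i ∨ j = 2 * i + 1) ∧ w = u j

/-- The walk through the values of a function along which consecutive values are adjacent. -/
def walkOfFun (G : SimpleGraph V) (f : ℕ → V) :
    (n : ℕ) → (∀ i < n, G.Adj (f i) (f (i + 1))) → G.Walk (f 0) (f n)
  | 0, _ => .nil
  | n + 1, h => (walkOfFun G f n fun i hi => h i (by omega)).concat (h n (by omega))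

lemma support_walkOfFun (f : ℕ → V) (n : ℕ) (h : ∀ i < n, G.Adj (f i) (f (i + 1))) :
    (walkOfFun G f n h).support = (List.range (n + 1)).map f := by
  induction n with
  | zero => simp [walkOfFun]
  | succ n ih =>
    rw [walkOfFun, SimpleGraph.Walk.support_concat, ih, List.range_succ (n := n + 1)]
    simp

lemma isPath_walkOfFun (f : ℕ → V) (n : ℕ) (h : ∀ i < n, G.Adj (f i) (f (i + 1)))
    (hf : ∀ i j, i ≤ n → j ≤ n → f i = f j → i = j) : (walkOfFun G f n h).IsPath := by
  rw [SimpleGraph.Walk.isPath_def, support_walkOfFun]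
  refine List.Nodup.map_on ?_ List.nodup_range
  intro a ha b hb
  rw [List.mem_range] at ha hb
  exact hf a b (by omega) (by omega)

/-- In an acyclic graph, paths given by functions are determined by their ends. -/
lemma SimpleGraph.IsAcyclic.eq_of_injective_walks (hG : G.IsAcyclic) {f g : ℕ → V} {a b : ℕ}
    (hf : ∀ i < a, G.Adj (f i) (f (i + 1))) (hg : ∀ i < b, G.Adj (g i) (g (i + 1)))
    (hfi : ∀ i j, i ≤ a → j ≤ a → f i = f j → i = j)
    (hgi : ∀ i j, i ≤ b → j ≤ b → g i = g j → i = j)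
    (h0 : f 0 = g 0) (h1 : f a = g b) : a = b ∧ ∀ i ≤ a, f i = g i := by
  have key : (walkOfFun G f a hf).support = (walkOfFun G g b hg).support := by
    have := (hG.subsingleton_path _ _).elim ⟨_, isPath_walkOfFun f a hf hfi⟩
      ⟨(walkOfFun G g b hg).copy h0.symm h1.symm, by
        simpa using isPath_walkOfFun g b hg hgi⟩
    have := congrArg (fun p => p.1.support) this
    simpa using this
  rw [support_walkOfFun, support_walkOfFun] at key
  have hab : a = b := by simpa using congrArg List.length key
  subst hab
  refine ⟨rfl, fun i hi => ?_⟩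
  exact List.map_inj_left.1 key i (List.mem_range.2 (by omega))

/-- In an acyclic graph, adjacent vertices of a path are consecutive on it. -/
lemma SimpleGraph.IsAcyclic.eq_succ_of_adj (hG : G.IsAcyclic) {f : ℕ → V} {a : ℕ}
    (hf : ∀ i < a, G.Adj (f i) (f (i + 1)))
    (hfi : ∀ i j, i ≤ a → j ≤ a → f i = f j → i = j) {i j : ℕ} (hij : i < j) (hj : j ≤ a)
    (h : G.Adj (f i) (f j)) : j = i + 1 := by
  have := hG.eq_of_injective_walks (f := fun t => f (i + t)) (a := j - i)
    (g := fun t => if t = 0 then f i else f j) (b := 1)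
    (fun t ht => hf (i + t) (by omega))
    (fun t ht => by simpa [show t = 0 by omega] using h)
    (fun s t hs ht hst => by have := hfi _ _ (by omega) (by omega) hst; omega)
    (fun s t hs ht hst => by
      have hne := h.ne
      rcases Nat.le_one_iff_eq_zero_or_eq_one.1 hs with rfl | rfl <;>
      rcases Nat.le_one_iff_eq_zero_or_eq_one.1 ht with rfl | rfl <;> simp_all)
    (by simp) (by simp [show i + (j - i) = j by omega])
  omega

lemma IsTrap.reverse (h : IsTrap G M B n u) : IsTrap G M B n fun i => u (2 * n - i) where
  adj i hi := by
    have := h.adj (2 * n - (i + 1)) (by omega)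
    rw [show 2 * n - (i + 1) + 1 = 2 * n - i by omega] at this
    exact this.symm
  inj i j hi hj hij := by
    have := h.inj _ _ (by omega) (by omega) hij
    omega
  free i hi := h.free _ (by omega)
  nbr i hi w hw := by
    have hw' : G.Adj (u (2 * (n - i))) w := by rwa [show 2 * (n - i) = 2 * n - 2 * i by omega]
    rcases h.nbr (n - i) (by omega) w hw' with h' | ⟨j, hj, hji, rfl⟩
    · exact .inl h'
    · refine .inr ⟨2 * n - j, by omega, by omega, ?_⟩
      rw [show 2 * n - (2 * n - j) = j by omega]

/-- After Maker claims a vertex of odd index, the part of the trap before it is a trap. -/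
lemma IsTrap.left [DecidableEq V] (h : IsTrap G M B n u) {a : ℕ} (ha : a < n) {y : V}
    (hy : ∀ i ≤ 2 * a, u i ≠ y) :
    IsTrap G (insert (u (2 * a + 1)) M) (insert y B) a u where
  adj i hi := h.adj i (by omega)
  inj i j hi hj := h.inj i j (by omega) (by omega)
  free i hi := by
    have h1 := h.free i (by omega)
    have h2 : u i ≠ u (2 * a + 1) := fun e => by
      have := h.inj _ _ (by omega) (by omega) e
      omega
    simp [h1, h2, hy i hi]
  nbr i hi w hw := by
    rcases h.nbr i (by omega) w hw with h' | ⟨j, hj, hji, rfl⟩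
    · exact .inl (by simp [h'])
    · rcases eq_or_ne j (2 * a + 1) with rfl | hne
      · exact .inl (by simp)
      · exact .inr ⟨j, by omega, hji, rfl⟩

/-- After Maker claims a vertex of odd index, the part of the trap after it is a trap. -/
lemma IsTrap.right [DecidableEq V] (h : IsTrap G M B n u) {a b : ℕ} (hab : a + b + 1 = n) {y : V}
    (hy : ∀ i ≤ 2 * b, u (2 * n - i) ≠ y) :
    IsTrap G (insert (u (2 * a + 1)) M) (insert y B) b fun i => u (2 * n - i) := by
  have := h.reverse.left (a := b) (by omega) hy
  rwa [show 2 * n - (2 * b + 1) = 2 * a + 1 by omega] at this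

/-- Two traps hanging off a common vertex `v` combine to a trap once `v` is unclaimed. -/
lemma IsTrap.join [DecidableEq V] (hG : G.IsAcyclic) {v x y : V} {m : ℕ} {w : ℕ → V}
    (hvM : v ∉ M) (hvB : v ∉ B)
    (hu : IsTrap G (insert v M) (insert x B) n u) (hw : IsTrap G (insert v M) (insert y B) m w)
    (hvu : G.Adj v (u 0)) (hvw : G.Adj v (w 0)) (hne : u 0 ≠ w 0) :
    IsTrap G M B (n + m + 1) fun i =>
      if i ≤ 2 * n then u (2 * n - i) else if i = 2 * n + 1 then v else w (i - (2 * n + 2)) := by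
  have ext_adj : ∀ {k : ℕ} {f : ℕ → V} {z : V}, IsTrap G (insert v M) (insert z B) k f →
      G.Adj v (f 0) → ∀ i < 2 * k + 1,
        G.Adj (if i = 0 then v else f (i - 1)) (if i + 1 = 0 then v else f (i + 1 - 1)) := by
    intro k f z hf hvf i hi
    rcases Nat.eq_zero_or_pos i with rfl | hpos
    · simpa using hvf
    · have := hf.adj (i - 1) (by omega)
      rw [show i - 1 + 1 = i by omega] at this
      simpa [show i ≠ 0 by omega] using this
  have ne_v : ∀ {k : ℕ} {f : ℕ → V} {z : V}, IsTrap G (insert v M) (insert z B) k f →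
      ∀ i ≤ 2 * k, f i ≠ v := by
    intro k f z hf i hi e
    have := (hf.free i hi).1
    simp [e] at this
  have ext_inj : ∀ {k : ℕ} {f : ℕ → V} {z : V}, IsTrap G (insert v M) (insert z B) k f →
      ∀ i j, i ≤ 2 * k + 1 → j ≤ 2 * k + 1 →
        (if i = 0 then v else f (i - 1)) = (if j = 0 then v else f (j - 1)) → i = j := by
    intro k f z hf i j hi hj hij
    split_ifs at hij with h1 h2 h2
    · omega
    · exact absurd hij.symm (ne_v hf _ (by omega))
    · exact absurd hij (ne_v hf _ (by omega))
    · have := hf.inj _ _ (by omega) (by omega) hij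
      omega
  have disj : ∀ i j, i ≤ 2 * n → j ≤ 2 * m → u i ≠ w j := by
    intro i j hi hj e
    have := hG.eq_of_injective_walks (a := i + 1) (b := j + 1)
      (f := fun t => if t = 0 then v else u (t - 1)) (g := fun t => if t = 0 then v else w (t - 1))
      (fun t ht => ext_adj hu hvu t (by omega)) (fun t ht => ext_adj hw hvw t (by omega))
      (fun s t hs ht => ext_inj hu s t (by omega) (by omega))
      (fun s t hs ht => ext_inj hw s t (by omega) (by omega)) (by simp) (by simpa using e)
    exact hne (by simpa using this.2 1 (by omega))
  have adj_v : ∀ {k : ℕ} {f : ℕ → V} {z : V}, IsTrap G (insert v M) (insert z B) k f →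
      G.Adj v (f 0) → ∀ i ≤ 2 * k, G.Adj (f i) v → i = 0 := by
    intro k f z hf hvf i hi hadj
    have := hG.eq_succ_of_adj (ext_adj hf hvf) (ext_inj hf) (i := 0) (j := i + 1) (by omega)
      (by omega) (by simpa using hadj.symm)
    omega
  refine ⟨fun i hi => ?_, fun i j hi hj hij => ?_, fun i hi => ?_, fun i hi z hz => ?_⟩
  · rcases lt_trichotomy i (2 * n) with h | h | h
    · have := hu.adj (2 * n - (i + 1)) (by omega)
      rw [show 2 * n - (i + 1) + 1 = 2 * n - i by omega] at this
      simpa [h.le, show i + 1 ≤ 2 * n by omega] using this.symm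
    · subst h
      simpa using hvu.symm
    · rcases eq_or_ne i (2 * n + 1) with rfl | h'
      · simpa using hvw
      · have := hw.adj (i - (2 * n + 2)) (by omega)
        rw [show i - (2 * n + 2) + 1 = i + 1 - (2 * n + 2) by omega] at this
        simpa [show ¬ i ≤ 2 * n by omega, h', show ¬ i + 1 ≤ 2 * n by omega,
          show i ≠ 2 * n by omega] using this
  · split_ifs at hij with h1 h2 h3 h3 h4 h5 h5 h6
    · have := hu.inj _ _ (by omega) (by omega) hij
      omega
    · exact absurd hij (ne_v hu _ (by omega))
    · exact absurd hij (disj _ _ (by omega) (by omega))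
    · exact absurd hij.symm (ne_v hu _ (by omega))
    · omega
    · exact absurd hij.symm (ne_v hw _ (by omega))
    · exact absurd hij.symm (disj _ _ (by omega) (by omega))
    · exact absurd hij (ne_v hw _ (by omega))
    · have := hw.inj _ _ (by omega) (by omega) hij
      omega
  · split_ifs with h1 h2
    · have := hu.free (2 * n - i) (by omega)
      simp only [Finset.mem_insert, not_or] at this
      exact ⟨this.1.2, this.2.2⟩
    · exact ⟨hvM, hvB⟩
    · have := hw.free (i - (2 * n + 2)) (by omega)
      simp only [Finset.mem_insert, not_or] at this
      exact ⟨this.1.2, this.2.2⟩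
  · split_ifs at hz with h1 h2
    · rw [show 2 * n - 2 * i = 2 * (n - i) by omega] at hz
      rcases hu.nbr (n - i) (by omega) z hz with h | ⟨j, hj, hji, rfl⟩
      · rcases Finset.mem_insert.1 h with rfl | h
        · have := adj_v hu hvu _ (by omega) hz
          exact .inr ⟨2 * n + 1, by omega, by omega, by simp⟩
        · exact .inl h
      · refine .inr ⟨2 * n - j, by omega, by omega, ?_⟩
        simp [show 2 * n - (2 * n - j) = j by omega]
    · omega
    · rw [show 2 * i - (2 * n + 2) = 2 * (i - n - 1) by omega] at hz
      rcases hw.nbr (i - n - 1) (by omega) z hz with h | ⟨j, hj, hji, rfl⟩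
      · rcases Finset.mem_insert.1 h with rfl | h
        · have := adj_v hw hvw _ (by omega) hz
          exact .inr ⟨2 * n + 1, by omega, by omega, by simp⟩
        · exact .inl h
      · refine .inr ⟨2 * n + 2 + j, by omega, by omega, ?_⟩
        simp [show ¬ 2 * n + 2 + j ≤ 2 * n by omega, show 2 * n + 2 + j ≠ 2 * n + 1 by omega]

/-- The path `c, b, b'` as a function. -/
def legFun (c b b' : V) (t : ℕ) : V := if t = 0 then c else if t = 1 then b else b'

lemma legFun_adj {c b b' : V} (hb : G.Adj c b) (hb' : G.Adj b b') (i : ℕ) (hi : i < 2) :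
    G.Adj (legFun c b b' i) (legFun c b b' (i + 1)) := by
  interval_cases i <;> simp [legFun, hb, hb']

lemma legFun_inj {c b b' : V} (hb : G.Adj c b) (hb' : G.Adj b b') (hne : b' ≠ c) (i j : ℕ)
    (hi : i ≤ 2) (hj : j ≤ 2) (hij : legFun c b b' i = legFun c b b' j) : i = j := by
  interval_cases i <;> interval_cases j <;>
    simp [legFun, hb.ne, hb.ne', hb'.ne, hb'.ne', hne, hne.symm] at hij ⊢

/-- In an acyclic graph, a path from `c` to `b` or to a neighbour `b'` of `b` runs through `b`
first. -/
lemma SimpleGraph.IsAcyclic.eq_of_leg (hG : G.IsAcyclic) {c b b' : V} (hb : G.Adj c b)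
    (hb' : G.Adj b b') (hne : b' ≠ c) {f : ℕ → V} {a p : ℕ}
    (hf : ∀ i < a, G.Adj (f i) (f (i + 1)))
    (hfi : ∀ i j, i ≤ a → j ≤ a → f i = f j → i = j) (h0 : f 0 = c) (hp : 1 ≤ p) (hp' : p ≤ 2)
    (h1 : f a = legFun c b b' p) : f 1 = b := by
  have := hG.eq_of_injective_walks (g := legFun c b b') (b := p) hf
    (fun i hi => legFun_adj hb hb' i (by omega)) hfi
    (fun i j hi hj => legFun_inj hb hb' hne i j (by omega) (by omega))
    (by simpa [legFun] using h0) h1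
  simpa [legFun] using this.2 1 (by omega)

/-- In an acyclic graph, a path meeting all edges leaves no room for a vertex with three legs of
length two. -/
lemma SimpleGraph.IsAcyclic.no_spider (hG : G.IsAcyclic) {f : ℕ → V} {L : ℕ}
    (hf : ∀ i < L, G.Adj (f i) (f (i + 1)))
    (hfi : ∀ i j, i ≤ L → j ≤ L → f i = f j → i = j)
    (hcov : ∀ x y, G.Adj x y → ∃ i ≤ L, f i = x ∨ f i = y) {c b b' d d' v v' : V}
    (hb : G.Adj c b) (hb' : G.Adj b b') (hbc : b' ≠ c)
    (hd : G.Adj c d) (hd' : G.Adj d d') (hdc : d' ≠ c)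
    (hv : G.Adj c v) (hv' : G.Adj v v') (hvc : v' ≠ c)
    (hbd : b ≠ d) (hvb : v ≠ b) (hvd : v ≠ d) : False := by
  have cover : ∀ {b b' : V}, G.Adj b b' → ∃ i ≤ L, ∃ p, 1 ≤ p ∧ p ≤ 2 ∧ f i = legFun c b b' p := by
    intro b b' h
    obtain ⟨i, hi, h | h⟩ := hcov _ _ h
    · exact ⟨i, hi, 1, le_rfl, by omega, by simp [legFun, h]⟩
    · exact ⟨i, hi, 2, by omega, le_rfl, by simp [legFun, h]⟩
  have through : ∀ {b b' d d' : V}, G.Adj c b → G.Adj b b' → b' ≠ c → G.Adj c d → G.Adj d d' →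
      d' ≠ c → b ≠ d → ∀ i j, i < j → j ≤ L → ∀ p q, 1 ≤ p → p ≤ 2 → 1 ≤ q → q ≤ 2 →
      f i = legFun c b b' p → f j = legFun c d d' q → ∃ s ≤ L, f s = c := by
    intro b b' d d' hb hb' hbc hd hd' hdc hbd i j hij hj p q hp hp' hq hq' hip hjq
    have disj : ∀ r s, r ≤ 2 → 1 ≤ s → s ≤ 2 → legFun c b b' r ≠ legFun c d d' s := by
      intro r s hr hs hs' e
      have := hG.eq_of_leg hd hd' hdc (f := legFun c b b') (a := r)
        (fun i hi => legFun_adj hb hb' i (by omega))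
        (fun i j hi hj => legFun_inj hb hb' hbc i j (by omega) (by omega)) rfl hs hs' e
      exact hbd this
    have := hG.eq_of_injective_walks (f := fun t => f (i + t)) (a := j - i)
      (g := fun t => if t ≤ p then legFun c b b' (p - t) else legFun c d d' (t - p)) (b := p + q)
      (fun t ht => hf (i + t) (by omega))
      (fun t ht => by
        rcases lt_trichotomy t p with h | rfl | h
        · have := legFun_adj hb hb' (p - (t + 1)) (by omega)
          rw [show p - (t + 1) + 1 = p - t by omega] at this
          simpa [h.le, show t + 1 ≤ p by omega] using this.symm
        · simpa [legFun] using hd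
        · have := legFun_adj hd hd' (t - p) (by omega)
          rw [show t - p + 1 = t + 1 - p by omega] at this
          simpa [show ¬ t ≤ p by omega, show ¬ t + 1 ≤ p by omega] using this)
      (fun s t hs ht hst => by have := hfi _ _ (by omega) (by omega) hst; omega)
      (fun s t hs ht hst => by
        split_ifs at hst with h1 h2 h2
        · have := legFun_inj hb hb' hbc _ _ (by omega) (by omega) hst
          omega
        · exact absurd hst (disj _ _ (by omega) (by omega) (by omega))
        · exact absurd hst.symm (disj _ _ (by omega) (by omega) (by omega))
        · have := legFun_inj hd hd' hdc _ _ (by omega) (by omega) hst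
          omega)
      (by simpa using hip)
      (by simpa [show i + (j - i) = j by omega, show ¬ q = 0 by omega] using hjq)
    exact ⟨i + p, by omega, by simpa [legFun] using this.2 p (by omega)⟩
  obtain ⟨i, hi, p, hp, hp', hip⟩ := cover hb'
  obtain ⟨j, hj, q, hq, hq', hjq⟩ := cover hd'
  obtain ⟨k, hk, r, hr, hr', hkr⟩ := cover hv'
  obtain ⟨s, hs, hsc⟩ : ∃ s ≤ L, f s = c := by
    rcases lt_trichotomy i j with h | h | h
    · exact through hb hb' hbc hd hd' hdc hbd i j h hj p q hp hp' hq hq' hip hjq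
    · have := hG.eq_of_leg hd hd' hdc (f := legFun c b b') (a := p)
        (fun i hi => legFun_adj hb hb' i (by omega))
        (fun i j hi hj => legFun_inj hb hb' hbc i j (by omega) (by omega)) rfl hq hq'
        (by rw [← hip, ← hjq, h])
      exact absurd this hbd
    · exact through hd hd' hdc hb hb' hbc hbd.symm j i h hi q p hq hq' hp hp' hjq hip
  have side : ∀ {b b' : V}, G.Adj c b → G.Adj b b' → b' ≠ c → ∀ i ≤ L, ∀ p, 1 ≤ p → p ≤ 2 →
      f i = legFun c b b' p → (s < i ∧ f (s + 1) = b) ∨ (i < s ∧ f (s - 1) = b) := by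
    intro b b' hb hb' hbc i hi p hp hp' hip
    rcases lt_trichotomy i s with h | rfl | h
    · refine .inr ⟨h, ?_⟩
      refine hG.eq_of_leg hb hb' hbc (f := fun t => f (s - t)) (a := s - i) (fun t ht => ?_)
        (fun x y hx hy hxy => ?_) (by simpa using hsc) hp hp' ?_
      · have := hf (s - (t + 1)) (by omega)
        rw [show s - (t + 1) + 1 = s - t by omega] at this
        exact this.symm
      · have := hfi _ _ (by omega) (by omega) hxy
        omega
      · simpa [show s - (s - i) = i by omega] using hip
    · have := legFun_inj hb hb' hbc 0 p (by omega) hp' (by rw [← hip, hsc]; simp [legFun])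
      omega
    · refine .inl ⟨h, ?_⟩
      refine hG.eq_of_leg hb hb' hbc (f := fun t => f (s + t)) (a := i - s)
        (fun t ht => hf (s + t) (by omega))
        (fun x y hx hy hxy => ?_) (by simpa using hsc) hp hp' ?_
      · have := hfi _ _ (by omega) (by omega) hxy
        omega
      · simpa [show s + (i - s) = i by omega] using hip
  rcases side hb hb' hbc i hi p hp hp' hip with ⟨-, h1⟩ | ⟨-, h1⟩ <;>
  rcases side hd hd' hdc j hj q hq hq' hjq with ⟨-, h2⟩ | ⟨-, h2⟩ <;>
  rcases side hv hv' hvc k hk r hr hr' hkr with ⟨-, h3⟩ | ⟨-, h3⟩ <;>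
  first
  | exact hbd (h1.symm.trans h2)
  | exact hvb (h3.symm.trans h1)
  | exact hvd (h3.symm.trans h2)

end Traps

lemma SimpleGraph.Walk.IsPath.getVert_inj {V : Type} {G : SimpleGraph V} {a b : V}
    {P : G.Walk a b} (hP : P.IsPath) (i j : ℕ) (hi : i ≤ P.length) (hj : j ≤ P.length)
    (h : P.getVert i = P.getVert j) : i = j :=
  hP.getVert_injOn hi hj h

/-- A vertex of a caterpillar with two non-leaf neighbours has only leaves as other neighbours. -/
lemma IsCaterpillar.eq_of_adj {V : Type} [Fintype V] {T : SimpleGraph V} (hT : IsCaterpillar T)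
    {c b b' d d' v v' : V}
    (hb : T.Adj c b) (hb' : T.Adj b b') (hbc : b' ≠ c)
    (hd : T.Adj c d) (hd' : T.Adj d d') (hdc : d' ≠ c)
    (hv : T.Adj c v) (hbd : b ≠ d) (hvb : v ≠ b) (hvd : v ≠ d) (hv' : T.Adj v v') : v' = c := by
  obtain ⟨hT, -, x, y, P, hP, hcov⟩ := hT
  by_contra hvc
  refine hT.isAcyclic.no_spider (f := P.getVert) (L := P.length)
    (fun i hi => P.adj_getVert_succ hi) hP.getVert_inj ?_
    hb hb' hbc hd hd' hdc hv hv' hvc hbd hvb hvd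
  intro x y h
  obtain ⟨z, hz, hzP⟩ := hcov s(x, y) h
  obtain ⟨i, rfl, hi⟩ := SimpleGraph.Walk.mem_support_iff_exists_getVert.1 hzP
  exact ⟨i, hi, Sym2.mem_iff.1 hz⟩

section Game

variable {V : Type} [Fintype V] {G : SimpleGraph V} {M B : Finset V} {n : ℕ} {u : ℕ → V}

lemma exists_nbhdHyp_subset_iff :
    (∃ e ∈ nbhdHyp G, e ⊆ M) ↔ ∃ v ∈ M, ∀ w, G.Adj v w → w ∈ M := by
  simp only [nbhdHyp, Set.mem_range, exists_exists_eq_and, closedNbhdFinset, Finset.subset_iff,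
    Finset.mem_filter, Finset.mem_univ, true_and, forall_eq_or_imp]

/-- Maker wins on a trap of order less than `2 ^ j` within `j` moves. -/
lemma IsTrap.mbVal_le {j : ℕ} (h : IsTrap G M B n u) (hj : 2 * n + 2 ≤ 2 ^ j) :
    mbVal (nbhdHyp G) true M B ≤ j := by
  induction j generalizing n u M B with
  | zero => simp at hj
  | succ j ih =>
    rw [mbVal]
    split_ifs with hE
    · exact zero_le
    have hmove : ∀ v, v ∉ M → v ∉ B → mbVal (nbhdHyp G) false (insert v M) B ≤ j →
        ⨅ v ∈ Finset.univ \ (M ∪ B), (1 + mbVal (nbhdHyp G) false (insert v M) B)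
          ≤ ((j + 1 : ℕ) : ℕ∞) := by
      intro v hvM hvB hv
      refine (iInf₂_le v (by simp [hvM, hvB])).trans ?_
      rw [add_comm 1, Nat.cast_add, Nat.cast_one]
      gcongr
    rcases Nat.eq_zero_or_pos n with rfl | hn
    · refine hmove (u 0) (h.free 0 le_rfl).1 (h.free 0 le_rfl).2 ?_
      rw [mbVal, if_pos]
      · exact zero_le
      · refine exists_nbhdHyp_subset_iff.2 ⟨u 0, by simp, fun w hw => ?_⟩
        rcases h.nbr 0 le_rfl w hw with h' | ⟨i, hi, hi', rfl⟩
        · exact Finset.mem_insert_of_mem h'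
        · omega
    · obtain ⟨a, b, hab, ha, hb⟩ :
          ∃ a b, a + b + 1 = n ∧ 2 * a + 2 ≤ 2 ^ j ∧ 2 * b + 2 ≤ 2 ^ j := by
        refine ⟨(n - 1) / 2, n - 1 - (n - 1) / 2, by omega, ?_, ?_⟩
        · rw [pow_succ] at hj; omega
        · rcases j with _ | j
          · simp at hj; omega
          · rw [pow_succ, pow_succ] at hj; rw [pow_succ]; omega
      refine hmove (u (2 * a + 1)) (h.free _ (by omega)).1 (h.free _ (by omega)).2 ?_
      rw [mbVal]
      split_ifs with hE' hS
      · exact zero_le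
      · have h0 := h.free 0 (by omega)
        have h1 : u 0 ≠ u (2 * a + 1) := fun e => by
          have := h.inj _ _ (by omega) (by omega) e
          omega
        have : u 0 ∈ Finset.univ \ (insert (u (2 * a + 1)) M ∪ B) := by simp [h0, h1]
        exact absurd this (by rw [hS]; exact Finset.notMem_empty _)
      · refine iSup₂_le fun y _ => ?_
        by_cases hy : ∀ i ≤ 2 * a, u i ≠ y
        · exact ih (h.left (by omega) hy) ha
        · push Not at hy
          obtain ⟨i, hi, rfl⟩ := hy
          refine ih (h.right hab fun k hk e => ?_) hb
          have := h.inj _ _ (by omega) (by omega) e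
          omega

/-- On a caterpillar, if every vertex claimed by Maker is dominated by Breaker and Maker wins
within `j` moves, then there is a trap of order less than `2 ^ j`. -/
lemma IsCaterpillar.exists_isTrap (hT : IsCaterpillar G) {j : ℕ} (hMB : Disjoint M B)
    (hdom : ∀ v ∈ M, ∃ z ∈ B, G.Adj v z) (hj : mbVal (nbhdHyp G) true M B ≤ j) :
    ∃ n u, IsTrap G M B n u ∧ 2 * n + 2 ≤ 2 ^ j := by
  induction j generalizing M B with
  | zero =>
    rw [mbVal] at hj
    split_ifs at hj with hE
    · obtain ⟨v, hv, hvM⟩ := exists_nbhdHyp_subset_iff.1 hE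
      obtain ⟨z, hzB, hz⟩ := hdom v hv
      exact absurd hzB (Finset.disjoint_left.1 hMB (hvM z hz))
    · have : (1 : ℕ∞) ≤ (0 : ℕ) := le_trans (le_iInf₂ fun v _ => le_self_add) hj
      simp at this
  | succ j ih =>
    rw [mbVal] at hj
    split_ifs at hj with hE
    · obtain ⟨v, hv, hvM⟩ := exists_nbhdHyp_subset_iff.1 hE
      obtain ⟨z, hzB, hz⟩ := hdom v hv
      exact absurd hzB (Finset.disjoint_left.1 hMB (hvM z hz))
    obtain ⟨v, hv, hvj⟩ : ∃ v ∈ Finset.univ \ (M ∪ B),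
        mbVal (nbhdHyp G) false (insert v M) B ≤ j := by
      by_contra! hcon
      have : ((j + 2 : ℕ) : ℕ∞) ≤ (j + 1 : ℕ) := by
        refine le_trans (le_iInf₂ fun v hv => ?_) hj
        have := Order.add_one_le_of_lt (hcon v hv)
        calc ((j + 2 : ℕ) : ℕ∞) = 1 + (j + 1) := by push_cast; ring
          _ ≤ _ := by gcongr
      rw [Nat.cast_le] at this
      omega
    have hvM : v ∉ M := fun h => by simp [h] at hv
    have hvB : v ∉ B := fun h => by simp [h] at hv
    rw [mbVal] at hvj
    split_ifs at hvj with hE' hS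
    · obtain ⟨x, hx, hxM⟩ := exists_nbhdHyp_subset_iff.1 hE'
      rcases Finset.mem_insert.1 hx with rfl | hx
      · refine ⟨0, fun _ => x, ⟨by simp, by simp, by simp [hvM, hvB], fun i hi w hw => .inl ?_⟩, ?_⟩
        · exact (Finset.mem_insert.1 (hxM w hw)).resolve_left hw.ne'
        · rw [pow_succ]
          have := Nat.one_le_two_pow (n := j)
          omega
      · obtain ⟨z, hzB, hz⟩ := hdom x hx
        rcases Finset.mem_insert.1 (hxM z hz) with rfl | h
        · exact absurd hzB hvB
        · exact absurd hzB (Finset.disjoint_left.1 hMB h)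
    · simp at hvj
    by_contra hno
    have reply : ∀ x, x ∉ M → x ≠ v → x ∉ B → ((∃ z ∈ B, G.Adj v z) ∨ G.Adj v x) →
        ∃ n u, IsTrap G (insert v M) (insert x B) n u ∧ 2 * n + 2 ≤ 2 ^ j ∧ G.Adj v (u 0) := by
      intro x hxM hxv hxB hx
      obtain ⟨n, u, hu, hn⟩ := ih (M := insert v M) (B := insert x B)
        (by simp [hxM, hxv, hvB, hMB])
        (fun w hw => by
          rcases Finset.mem_insert.1 hw with rfl | hw
          · rcases hx with ⟨z, hz, hwz⟩ | hx
            · exact ⟨z, by simp [hz], hwz⟩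
            · exact ⟨x, by simp, hx⟩
          · obtain ⟨z, hz, hwz⟩ := hdom w hw
            exact ⟨z, by simp [hz], hwz⟩)
        ((le_iSup₂ (f := fun x _ => mbVal (nbhdHyp G) true (insert v M) (insert x B)) x
          (by simp [hxM, hxv, hxB])).trans hvj)
      have hfree : ∀ i ≤ 2 * n, u i ≠ v ∧ u i ∉ M ∧ u i ≠ x ∧ u i ∉ B := by
        intro i hi
        have := hu.free i hi
        simp only [Finset.mem_insert, not_or] at this
        tauto
      obtain ⟨i, hi, hiv⟩ : ∃ i ≤ n, G.Adj (u (2 * i)) v := by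
        by_contra! hcon
        refine hno ⟨n, u, ⟨hu.adj, hu.inj, fun i hi => ?_, fun i hi w hw => ?_⟩, ?_⟩
        · exact ⟨(hfree i hi).2.1, (hfree i hi).2.2.2⟩
        · rcases hu.nbr i hi w hw with h | h
          · rcases Finset.mem_insert.1 h with rfl | h
            · exact absurd hw (hcon i hi)
            · exact .inl h
          · exact .inr h
        · rw [pow_succ]
          omega
      rcases Nat.eq_zero_or_pos i with rfl | hpos
      · exact ⟨n, u, hu, hn, hiv.symm⟩
      rcases hi.eq_or_lt with rfl | hlt
      · exact ⟨i, _, hu.reverse, hn, by simpa using hiv.symm⟩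
      exfalso
      obtain ⟨i, rfl⟩ := Nat.exists_eq_add_of_le' hpos
      have ne : ∀ s t, s ≤ 2 * n → t ≤ 2 * n → s ≠ t → u s ≠ u t := fun s t hs ht hst e =>
        hst (hu.inj s t hs ht e)
      have leaf : ∀ w, G.Adj v w → w = u (2 * i + 2) := fun w hw =>
        hT.eq_of_adj (c := u (2 * i + 2)) (b := u (2 * i + 1)) (b' := u (2 * i))
          (d := u (2 * i + 3)) (d' := u (2 * i + 4)) (hu.adj (2 * i + 1) (by omega)).symm
          (hu.adj (2 * i) (by omega)).symm (ne _ _ (by omega) (by omega) (by omega))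
          (hu.adj (2 * i + 2) (by omega)) (hu.adj (2 * i + 3) (by omega))
          (ne _ _ (by omega) (by omega) (by omega)) hiv
          (ne _ _ (by omega) (by omega) (by omega)) (hfree _ (by omega)).1.symm
          (hfree _ (by omega)).1.symm hw
      have h2 := hfree (2 * i + 2) (by omega)
      rcases hx with ⟨z, hz, hvz⟩ | hx
      · exact h2.2.2.2 (leaf z hvz ▸ hz)
      · exact h2.2.2.1 (leaf x hx).symm
    obtain ⟨x, hxM, hxv, hxB, hx⟩ :
        ∃ x, x ∉ M ∧ x ≠ v ∧ x ∉ B ∧ ((∃ z ∈ B, G.Adj v z) ∨ G.Adj v x) := by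
      by_cases hz : ∃ z ∈ B, G.Adj v z
      · obtain ⟨x, hx⟩ := Finset.nonempty_iff_ne_empty.2 hS
        simp only [Finset.mem_sdiff, Finset.mem_univ, true_and, Finset.mem_union,
          Finset.mem_insert, not_or] at hx
        exact ⟨x, hx.1.2, hx.1.1, hx.2, .inl hz⟩
      · rw [exists_nbhdHyp_subset_iff] at hE'
        push Not at hE' hz
        obtain ⟨x, hvx, hx⟩ := hE' v (by simp)
        simp only [Finset.mem_insert, not_or] at hx
        exact ⟨x, hx.2, hx.1, fun h => hz x h hvx, .inr hvx⟩
    obtain ⟨n, u, hu, hn, hvu⟩ := reply x hxM hxv hxB hx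
    have h0 := hu.free 0 (by omega)
    simp only [Finset.mem_insert, not_or] at h0
    obtain ⟨m, w, hw, hm, hvw⟩ := reply (u 0) h0.1.2 h0.1.1 h0.2.2 (.inr hvu)
    have h1 := hw.free 0 (by omega)
    simp only [Finset.mem_insert, not_or] at h1
    refine hno ⟨_, _, hu.join hT.1.isAcyclic hvM hvB hw hvu hvw (Ne.symm h1.2.1), ?_⟩
    rw [pow_succ]
    omega

end Game

/-- The walk along a trap of the initial position is an inclusion-maximal path. -/
lemma IsTrap.isMaximalPath {V : Type} {T : SimpleGraph V} {n : ℕ} {u : ℕ → V}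
    (hT : T.IsAcyclic) (hn : 0 < n) (h : IsTrap T ∅ ∅ n u) :
    IsMaximalPath T (walkOfFun T u (2 * n) h.adj) := by
  refine ⟨isPath_walkOfFun _ _ _ h.inj, fun a b Q hQ hsub => ?_⟩
  have ends : ∀ i, (i = 0 ∨ i = n) → ∃ t ≤ Q.length, Q.getVert t = u (2 * i) ∧
      (t = 0 ∨ t = Q.length) := by
    intro i hi
    have hmem : u (2 * i) ∈ Q.support := by
      rw [← List.mem_toFinset]
      refine hsub ?_
      rw [List.mem_toFinset, support_walkOfFun]
      exact List.mem_map_of_mem (List.mem_range.2 (by omega))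
    obtain ⟨t, ht, htl⟩ := SimpleGraph.Walk.mem_support_iff_exists_getVert.1 hmem
    refine ⟨t, htl, ht, ?_⟩
    by_contra! hcon
    have h1 := Q.adj_getVert_succ (i := t) (by omega)
    have h2 := Q.adj_getVert_succ (i := t - 1) (by omega)
    rw [show t - 1 + 1 = t by omega] at h2
    rw [ht] at h1 h2
    rcases h.nbr i (by omega) _ h1 with h' | ⟨j, hj, hji, hju⟩
    · simp at h'
    rcases h.nbr i (by omega) _ h2.symm with h' | ⟨k, hk, hki, hku⟩
    · simp at h'
    have hjk : j = k := by omega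
    have := hQ.getVert_inj _ _ (by omega) (by omega) (hju.trans (hjk ▸ hku.symm))
    omega
  obtain ⟨s, hs, hsu, hs'⟩ := ends 0 (.inl rfl)
  obtain ⟨t, ht, htu, ht'⟩ := ends n (.inr rfl)
  have hst : s ≠ t := by
    rintro rfl
    have := h.inj _ _ (by omega) le_rfl (hsu.symm.trans htu)
    omega
  refine Finset.Subset.antisymm (fun x hx => ?_) hsub
  rw [List.mem_toFinset] at hx ⊢
  obtain ⟨i, rfl, hi⟩ := SimpleGraph.Walk.mem_support_iff_exists_getVert.1 hx
  rw [support_walkOfFun]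
  have hQi := hQ.getVert_inj
  rcases hs' with rfl | rfl
  · obtain rfl : t = Q.length := by omega
    have := hT.eq_of_injective_walks (f := Q.getVert) (a := Q.length)
      (fun i hi => Q.adj_getVert_succ hi) h.adj hQi h.inj hsu htu
    rw [this.2 i hi]
    exact List.mem_map_of_mem (List.mem_range.2 (by omega))
  · obtain rfl : t = 0 := by omega
    have := hT.eq_of_injective_walks (f := fun i => Q.getVert (Q.length - i)) (a := Q.length)
      (fun i hi => by
        have := Q.adj_getVert_succ (i := Q.length - (i + 1)) (by omega)
        rw [show Q.length - (i + 1) + 1 = Q.length - i by omega] at this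
        exact this.symm)
      h.adj
      (fun i j hi hj hij => by
        have := hQi _ _ (by omega) (by omega) hij
        omega)
      h.inj (by simpa using hsu) (by simpa using htu)
    have h2 := this.2 (Q.length - i) (by omega)
    rw [show Q.length - (Q.length - i) = i by omega] at h2
    rw [h2]
    exact List.mem_map_of_mem (List.mem_range.2 (by omega))

section Paths

variable {V : Type} [Fintype V] {T : SimpleGraph V}

/-- A trap has order at least three, since a caterpillar has no isolated vertices. -/
lemma IsCaterpillar.pos_of_isTrap (hT : IsCaterpillar T) {n : ℕ} {u : ℕ → V}
    (h : IsTrap T ∅ ∅ n u) : 0 < n := by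
  by_contra! hn
  obtain rfl : n = 0 := by omega
  have : Nontrivial V := Fintype.one_lt_card_iff_nontrivial.1 (by have := hT.2.1; omega)
  obtain ⟨w, hw⟩ := hT.1.connected.preconnected.exists_adj_of_nontrivial (u 0)
  rcases h.nbr 0 le_rfl w hw with h' | ⟨j, hj, hj', -⟩
  · simp at h'
  · omega

/-- A shortest trap of a caterpillar yields a clean path. -/
lemma IsCaterpillar.exists_path_of_isTrap (hT : IsCaterpillar T) {n : ℕ} {u : ℕ → V}
    (h : IsTrap T ∅ ∅ n u) :
    ∃ (a b : V) (P : T.Walk a b), IsCleanPath T P ∧ IsMaximalPath T P ∧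
      Odd P.support.length ∧ P.support.length ≤ 2 * n + 1 := by
  induction n using Nat.strong_induction_on generalizing u with
  | _ n ih =>
  by_cases hsmall : ∃ m < n, ∃ w, IsTrap T ∅ ∅ m w
  · obtain ⟨m, hm, w, hw⟩ := hsmall
    obtain ⟨a, b, P, h1, h2, h3, h4⟩ := ih m hm hw
    exact ⟨a, b, P, h1, h2, h3, by omega⟩
  have hn := hT.pos_of_isTrap h
  have hlen : (walkOfFun T u (2 * n) h.adj).support.length = 2 * n + 1 := by
    simp [support_walkOfFun]
  refine ⟨_, _, walkOfFun T u (2 * n) h.adj, ⟨isPath_walkOfFun _ _ _ h.inj, fun i hi hi' => ?_⟩,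
    h.isMaximalPath hT.1.isAcyclic hn, by rw [hlen]; exact ⟨n, rfl⟩, by omega⟩
  rw [hlen] at hi'
  have hget : (walkOfFun T u (2 * n) h.adj).support.getD i (u 0) = u i := by
    rw [support_walkOfFun, List.getD_eq_getElem _ _ (by simp; omega)]
    simp
  rw [hget]
  obtain ⟨i, rfl⟩ := Nat.exists_eq_add_of_le' hi
  have ne : ∀ s t, s ≤ 2 * n → t ≤ 2 * n → s ≠ t → u s ≠ u t := fun s t hs ht hst e =>
    hst (h.inj s t hs ht e)
  have hprev := (h.adj (i + 1) (by omega)).symm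
  have hnext := h.adj (i + 2) (by omega)
  rw [← SimpleGraph.card_neighborFinset_eq_degree,
    show T.neighborFinset (u (i + 2)) = {u (i + 1), u (i + 3)} from ?_,
    Finset.card_pair (ne _ _ (by omega) (by omega) (by omega))]
  ext w
  simp only [SimpleGraph.mem_neighborFinset, Finset.mem_insert, Finset.mem_singleton]
  refine ⟨fun hw => ?_, by rintro (rfl | rfl) <;> assumption⟩
  by_contra! hcon
  rcases Nat.even_or_odd' (i + 2) with ⟨k, hk | hk⟩
  · rw [hk] at hw
    rcases h.nbr k (by omega) w hw with h' | ⟨j, hj, hjk, rfl⟩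
    · simp at h'
    · rcases hjk with hjk | hjk
      · exact hcon.1 (by rw [show j = i + 1 by omega])
      · exact hcon.2 (by rw [show j = i + 3 by omega])
  · have leaf : ∀ z, T.Adj w z → z = u (i + 2) := fun z hz =>
      hT.eq_of_adj hprev (h.adj i (by omega)).symm (ne _ _ (by omega) (by omega) (by omega))
        hnext (h.adj (i + 3) (by omega)) (ne _ _ (by omega) (by omega) (by omega)) hw
        (ne _ _ (by omega) (by omega) (by omega)) hcon.1 hcon.2 hz
    have hwu : ∀ j ≤ i + 2, u j ≠ w := by
      rintro j hj rfl
      rcases hj.eq_or_lt with rfl | hj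
      · exact hw.ne rfl
      · have := hT.1.isAcyclic.eq_succ_of_adj h.adj h.inj hj (by omega) hw.symm
        exact hcon.1 (by rw [show j = i + 1 by omega])
    refine hsmall ⟨k + 1, by omega, fun j => if j = i + 3 then w else u j, fun j hj => ?_,
      fun a b ha hb hab => ?_, by simp, fun j hj z hz => .inr ?_⟩
    · rcases eq_or_ne j (i + 2) with rfl | hne
      · simpa using hw
      · simpa [show j ≠ i + 3 by omega, hne] using h.adj j (by omega)
    · split_ifs at hab with h1 h2 h2
      · omega
      · exact absurd hab.symm (hwu _ (by omega))
      · exact absurd hab (hwu _ (by omega))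
      · exact h.inj _ _ (by omega) (by omega) hab
    · rcases eq_or_ne (2 * j) (i + 3) with hj' | hj'
      · simp only [hj', if_true] at hz
        exact ⟨i + 2, by omega, by omega, by simpa using leaf z hz⟩
      · simp only [hj', if_false] at hz
        rcases h.nbr j (by omega) z hz with h' | ⟨l, hl, hlj, rfl⟩
        · simp at h'
        · exact ⟨l, by omega, hlj, by simp [show l ≠ i + 3 by omega]⟩

/-- A clean inclusion-maximal path of odd order is a trap of the initial position. -/
lemma IsCleanPath.isTrap (hT : T.IsAcyclic) {a b : V} {P : T.Walk a b} (hP : IsCleanPath T P)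
    (hmax : IsMaximalPath T P) {n : ℕ} (hn : P.support.length = 2 * n + 1) :
    IsTrap T ∅ ∅ n P.getVert := by
  have hlen : P.length = 2 * n := by
    rw [SimpleGraph.Walk.length_support] at hn
    omega
  have hadj : ∀ i < 2 * n, T.Adj (P.getVert i) (P.getVert (i + 1)) := fun i hi =>
    P.adj_getVert_succ (by omega)
  have hinj : ∀ i j, i ≤ 2 * n → j ≤ 2 * n → P.getVert i = P.getVert j → i = j :=
    fun i j hi hj => hP.1.getVert_inj i j (by omega) (by omega)
  have consecutive : ∀ i j, i ≤ 2 * n → j ≤ 2 * n → T.Adj (P.getVert i) (P.getVert j) →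
      j + 1 = i ∨ j = i + 1 := by
    intro i j hi hj h
    rcases lt_trichotomy i j with hij | rfl | hij
    · exact .inr (hT.eq_succ_of_adj hadj hinj hij hj h)
    · exact absurd rfl h.ne
    · exact .inl (hT.eq_succ_of_adj hadj hinj hij hi h.symm).symm
  have ends : ∀ {x y : V} (Q : T.Walk x y), Q.IsPath →
      Q.support.toFinset = P.support.toFinset → ∀ w, T.Adj x w → w ∈ P.support := by
    intro x y Q hQ hQP w hw
    by_contra hwP
    have hwQ : w ∉ Q.support := by
      rwa [← List.mem_toFinset, hQP, List.mem_toFinset]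
    have := hmax.2 _ _ (Q.cons hw.symm) (hQ.cons hwQ) (by
      rw [← hQP, SimpleGraph.Walk.support_cons, List.toFinset_cons]
      exact Finset.subset_insert _ _)
    refine hwP ?_
    rw [← List.mem_toFinset, ← this, SimpleGraph.Walk.support_cons]
    simp
  refine ⟨hadj, hinj, by simp, fun i hi w hw => .inr ?_⟩
  have hwP : w ∈ P.support := by
    rcases Nat.eq_zero_or_pos i with rfl | hpos
    · exact ends P hP.1 rfl w (by simpa using hw)
    rcases hi.eq_or_lt with rfl | hlt
    · refine ends P.reverse hP.1.reverse (by simp) w ?_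
      rwa [← hlen, SimpleGraph.Walk.getVert_length] at hw
    · have hdeg := hP.2 (2 * i) (by omega) (by omega)
      rw [List.getD_eq_getElem _ _ (by omega), SimpleGraph.Walk.support_getElem_eq_getVert,
        ← SimpleGraph.card_neighborFinset_eq_degree] at hdeg
      have h1 := hadj (2 * i - 1) (by omega)
      rw [show 2 * i - 1 + 1 = 2 * i by omega] at h1
      have hsub : {P.getVert (2 * i - 1), P.getVert (2 * i + 1)} ⊆
          T.neighborFinset (P.getVert (2 * i)) := by
        intro z hz
        rw [SimpleGraph.mem_neighborFinset]
        rcases Finset.mem_insert.1 hz with rfl | hz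
        · exact h1.symm
        · rw [Finset.mem_singleton.1 hz]
          exact hadj _ (by omega)
      have heq := Finset.eq_of_subset_of_card_le hsub (by
        rw [hdeg, Finset.card_pair]
        intro e
        have := hinj _ _ (by omega) (by omega) e
        omega)
      have hw' : w ∈ T.neighborFinset (P.getVert (2 * i)) := by simpa using hw
      rw [← heq, Finset.mem_insert, Finset.mem_singleton] at hw'
      rcases hw' with rfl | rfl <;> exact P.getVert_mem_support _
  obtain ⟨j, rfl, hj⟩ := SimpleGraph.Walk.mem_support_iff_exists_getVert.1 hwP
  exact ⟨j, by omega, consecutive _ _ (by omega) (by omega) hw, rfl⟩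

/-- If Staller wins within `j` moves, a caterpillar has an odd clean maximal path of order at most
`2 ^ j`. -/
lemma IsCaterpillar.exists_path_of_gammaSMB'_le (hT : IsCaterpillar T) {j : ℕ}
    (hj : gammaSMB' T ≤ j) :
    ∃ (a b : V) (P : T.Walk a b), IsCleanPath T P ∧ IsMaximalPath T P ∧
      Odd P.support.length ∧ P.support.length ≤ 2 ^ j := by
  obtain ⟨n, u, hu, hn⟩ := hT.exists_isTrap (by simp) (by simp) hj
  obtain ⟨a, b, P, h1, h2, h3, h4⟩ := hT.exists_path_of_isTrap hu
  exact ⟨a, b, P, h1, h2, h3, by omega⟩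

end Paths

/-- For a caterpillar `T`: if `𝒫_co(T) = ∅` then `γ'_SMB(T) = ∞`; otherwise
`γ'_SMB(T) = ⌈log₂ p(T)⌉`, where `p(T)` is the minimum order of an odd
inclusion-maximal clean path of `T`. -/
theorem stmt_18 {V : Type} [Fintype V] (T : SimpleGraph V)
    (hT : IsCaterpillar T) :
    (¬ HasOddMaximalCleanPath T → gammaSMB' T = ⊤) ∧
    (∀ p : ℕ,
      ((∃ (u v : V) (P : T.Walk u v), IsCleanPath T P ∧ IsMaximalPath T P ∧
          Odd P.support.length ∧ P.support.length = p) ∧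
        (∀ (u v : V) (P : T.Walk u v), IsCleanPath T P → IsMaximalPath T P →
          Odd P.support.length → p ≤ P.support.length)) →
      gammaSMB' T = (Nat.clog 2 p : ℕ)) := by
  refine ⟨fun hno => ?_, fun p hp => ?_⟩
  · by_contra hne
    obtain ⟨j, hj⟩ := ENat.ne_top_iff_exists.1 hne
    obtain ⟨a, b, P, h1, h2, h3, -⟩ := hT.exists_path_of_gammaSMB'_le hj.symm.le
    exact hno ⟨a, b, P, h1, h2, h3⟩
  · obtain ⟨⟨a, b, P, h1, h2, ⟨n, hn⟩, rfl⟩, hmin⟩ := hp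
    have htrap := h1.isTrap hT.1.isAcyclic h2 hn
    have hpos := hT.pos_of_isTrap htrap
    have hle : gammaSMB' T ≤ (Nat.clog 2 P.support.length : ℕ) := by
      refine htrap.mbVal_le ?_
      have h := Nat.le_pow_clog one_lt_two P.support.length
      have hclog : Nat.clog 2 P.support.length ≠ 0 := by
        intro h0
        rw [h0] at h
        omega
      obtain ⟨k, hk⟩ := Nat.exists_eq_succ_of_ne_zero hclog
      rw [hk, Nat.succ_eq_add_one, pow_succ] at h ⊢
      omega
    refine le_antisymm hle ?_
    obtain ⟨j, hj⟩ := ENat.ne_top_iff_exists.1 (ne_top_of_le_ne_top (ENat.natCast_ne_top _) hle)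
    obtain ⟨c, d, Q, h3, h4, h5, h6⟩ := hT.exists_path_of_gammaSMB'_le hj.symm.le
    rw [← hj, Nat.cast_le]
    exact Nat.clog_le_of_le_pow ((hmin c d Q h3 h4 h5).trans h6)
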